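/- Let f ∈ (0, 1/2), u ∈ ℝ with u ≠ 0, and x, x̂ ∈ ℝ. Then (1/N) g_N(u/N) → (x² + x̂²)/2 − x x̂ · sin(2π u)/(2π u) as N → ∞. -/

import Mathlib

open Finset Real Filter

/-- The single-tone cost
`g_N(θ) = Σ_{n<N} (x sin(2πfn) − x̂ sin(2π(f+θ)n))²`. -/
noncomputable def singleToneCost (x xHat f θ : ℝ) (N : ℕ) : ℝ :=
  ∑ n ∈ Finset.range N,
    (x * Real.sin (2 * Real.pi * f * n) -
      xHat * Real.sin (2 * Real.pi * (f + θ) * n)) ^ 2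

theorem two_mul_sin_half_mul_sum_cos (t : ℝ) (N : ℕ) :
    2 * sin (t / 2) * ∑ n ∈ range N, cos (t * n) = sin (t * N - t / 2) + sin (t / 2) := by
  induction N with
  | zero => simp
  | succ N ih =>
    have h : t * ((N + 1 : ℕ) : ℝ) - t / 2 = t * N + t / 2 := by push_cast; ring
    rw [sum_range_succ, mul_add, ih, h, sin_add, sin_sub]
    ring

/-- Cosine averages vanish at frequencies converging to a non-resonant one. -/
theorem tendsto_average_cos_zero {t : ℕ → ℝ} {a : ℝ} (ht : Tendsto t atTop (nhds a))
    (ha : sin (a / 2) ≠ 0) :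
    Tendsto (fun N : ℕ => 1 / (N : ℝ) * ∑ n ∈ range N, cos (t N * n)) atTop (nhds 0) := by
  have hs : Tendsto (fun N => sin (t N / 2)) atTop (nhds (sin (a / 2))) :=
    (continuous_sin.tendsto _).comp (ht.div_const 2)
  have hbound : Tendsto (fun N : ℕ => (1 / (N : ℝ)) * (sin (t N * N - t N / 2) + sin (t N / 2)))
      atTop (nhds 0) := by
    refine squeeze_zero_norm (a := fun N : ℕ => 2 / (N : ℝ)) (fun N => ?_)
      (tendsto_const_div_atTop_nhds_zero_nat 2)
    have h : |sin (t N * N - t N / 2) + sin (t N / 2)| ≤ 2 :=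
      (abs_add_le _ _).trans
        (by linarith [abs_sin_le_one (t N * N - t N / 2), abs_sin_le_one (t N / 2)])
    rw [norm_eq_abs, abs_mul, abs_of_nonneg (by positivity : (0 : ℝ) ≤ 1 / (N : ℝ))]
    calc 1 / (N : ℝ) * _ ≤ 1 / (N : ℝ) * 2 := by gcongr
      _ = 2 / (N : ℝ) := by ring
  have hdiv := hbound.div (hs.const_mul 2) (mul_ne_zero two_ne_zero ha)
  rw [zero_div] at hdiv
  refine hdiv.congr' ?_
  filter_upwards [hs.eventually_ne ha] with N hN
  simp only [Pi.div_apply]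
  rw [← two_mul_sin_half_mul_sum_cos]
  field_simp

theorem tendsto_average_cos_div {v : ℝ} (hv : v ≠ 0) :
    Tendsto (fun N : ℕ => 1 / (N : ℝ) * ∑ n ∈ range N, cos (v / N * n)) atTop
      (nhds (sin v / v)) := by
  have h0 : Tendsto (fun N : ℕ => v / N / 2) atTop (nhds 0) := by
    simpa using (tendsto_const_div_atTop_nhds_zero_nat v).div_const 2
  have hnum : Tendsto (fun N : ℕ => sin (v - v / N / 2) + sin (v / N / 2)) atTop
      (nhds (sin v)) := by
    have h1 := (continuous_sin.tendsto _).comp (h0.const_sub v)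
    have h2 := (continuous_sin.tendsto _).comp h0
    simpa [Function.comp_def] using h1.add h2
  have hden : Tendsto (fun N : ℕ => 2 * sin (v / N / 2) * N) atTop (nhds v) := by
    have hsinc := ((continuous_sinc.tendsto 0).comp h0).const_mul v
    rw [sinc_zero, mul_one] at hsinc
    refine hsinc.congr' ?_
    filter_upwards [eventually_ne_atTop 0] with N hN
    have hN' : (N : ℝ) ≠ 0 := Nat.cast_ne_zero.mpr hN
    rw [Function.comp_apply, sinc_of_ne_zero (by positivity)]
    field_simp
  refine (hnum.div hden hv).congr' ?_
  filter_upwards [hden.eventually_ne hv, eventually_ne_atTop 0] with N hN hN0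
  have hN' : (N : ℝ) ≠ 0 := Nat.cast_ne_zero.mpr hN0
  have hsum := two_mul_sin_half_mul_sum_cos (v / N) N
  rw [div_mul_cancel₀ v hN'] at hsum
  have hs : sin (v / N / 2) ≠ 0 := fun h => hN (by simp [h])
  simp only [Pi.div_apply]
  rw [← hsum]
  generalize sin (v / N / 2) = s at hs
  field_simp

theorem singleToneCost_eq_sum_cos (x xHat f θ : ℝ) (N : ℕ) :
    singleToneCost x xHat f θ N =
      N * ((x ^ 2 + xHat ^ 2) / 2)
        - x ^ 2 / 2 * ∑ n ∈ range N, cos (4 * π * f * n)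
        - xHat ^ 2 / 2 * ∑ n ∈ range N, cos (4 * π * (f + θ) * n)
        - x * xHat * ∑ n ∈ range N, cos (2 * π * θ * n)
        + x * xHat * ∑ n ∈ range N, cos (2 * π * (2 * f + θ) * n) := by
  have hconst : (N : ℝ) * ((x ^ 2 + xHat ^ 2) / 2) =
      ∑ _n ∈ range N, (x ^ 2 + xHat ^ 2) / 2 := by simp
  rw [singleToneCost, hconst]
  simp only [mul_sum, ← sum_sub_distrib, ← sum_add_distrib]
  refine sum_congr rfl fun n _ => ?_
  set a := 2 * π * f * n with ha
  set b := 2 * π * (f + θ) * n with hb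
  rw [show 4 * π * f * n = 2 * a by rw [ha]; ring,
    show 4 * π * (f + θ) * n = 2 * b by rw [hb]; ring,
    show 2 * π * θ * n = b - a by rw [ha, hb]; ring,
    show 2 * π * (2 * f + θ) * n = b + a by rw [ha, hb]; ring,
    cos_two_mul, cos_two_mul, cos_sub, cos_add, cos_sq', cos_sq']
  ring

/-- With the perturbation scaled as `θ = u/N` (a fixed fraction `u` of a
Fourier bin), `(1/N) g_N(u/N) → (x² + x̂²)/2 − x·x̂·sin(2πu)/(2πu)`. -/
theorem singleToneCost_bin_fraction_perturbation (f u x xHat : ℝ)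
    (hf : f ∈ Set.Ioo (0 : ℝ) (1 / 2)) (hu : u ≠ 0) :
    Filter.Tendsto
      (fun N : ℕ => (1 / (N : ℝ)) * singleToneCost x xHat f (u / N) N)
      Filter.atTop
      (nhds ((x ^ 2 + xHat ^ 2) / 2 -
        x * xHat * (Real.sin (2 * Real.pi * u) / (2 * Real.pi * u)))) := by
  have hθ : Tendsto (fun N : ℕ => u / (N : ℝ)) atTop (nhds 0) :=
    tendsto_const_div_atTop_nhds_zero_nat u
  have hsin : sin (4 * π * f / 2) ≠ 0 := by
    refine (sin_pos_of_pos_of_lt_pi ?_ ?_).ne' <;> nlinarith [hf.1, hf.2, pi_pos]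
  have h₁ := tendsto_average_cos_zero (tendsto_const_nhds (x := 4 * π * f)) hsin
  have h₂ : Tendsto (fun N : ℕ => 4 * π * (f + u / N)) atTop (nhds (4 * π * f)) := by
    simpa using (hθ.const_add f).const_mul (4 * π)
  have h₃ : Tendsto (fun N : ℕ => 2 * π * (2 * f + u / N)) atTop (nhds (4 * π * f)) := by
    convert (hθ.const_add (2 * f)).const_mul (2 * π) using 2
    ring
  have h₄ := tendsto_average_cos_div (v := 2 * π * u) (by positivity)
  have hlim := ((((tendsto_const_nhds (x := (x ^ 2 + xHat ^ 2) / 2)).sub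
    (h₁.const_mul (x ^ 2 / 2))).sub
    ((tendsto_average_cos_zero h₂ hsin).const_mul (xHat ^ 2 / 2))).sub
    (h₄.const_mul (x * xHat))).add
    ((tendsto_average_cos_zero h₃ hsin).const_mul (x * xHat))
  simp only [mul_zero, sub_zero, add_zero] at hlim
  refine hlim.congr' ?_
  filter_upwards [eventually_ne_atTop 0] with N hN
  have hN' : (N : ℝ) ≠ 0 := Nat.cast_ne_zero.mpr hN
  rw [singleToneCost_eq_sum_cos, mul_div_assoc (2 * π) u]
  field_simp
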